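/- Let C be any congestion policy and A a doubly-substochastic M×T matrix. For every box x and round t with t+1 ≤ T, v_A(x,t+1) ≤ v_A(x,t); moreover, if A(x,t+1) > 0 then v_A(x,t+1) < v_A(x,t). -/

import Mathlib

open Finset

/-- `A` is a doubly-substochastic `M × T` matrix: boxes `1..M`, rounds `1..T`,
nonnegative entries, every row and every column sums to at most 1. -/
def Substochastic (M T : ℕ) (A : ℕ → ℕ → ℝ) : Prop :=
  (∀ x t, 0 ≤ A x t) ∧
  (∀ x ∈ Icc 1 M, ∑ t ∈ Icc 1 T, A x t ≤ 1) ∧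
  (∀ t ∈ Icc 1 T, ∑ x ∈ Icc 1 M, A x t ≤ 1)

/-- `N̄_A(x,t)`: the probability that `A` does not visit box `x` by (and including) round `t`. -/
def Nbar (A : ℕ → ℕ → ℝ) (x t : ℕ) : ℝ := 1 - ∑ s ∈ Icc 1 t, A x s

/-- `f` is a positive, nonincreasing probability distribution on boxes `1..M`. -/
def BoxDist (M : ℕ) (f : ℕ → ℝ) : Prop :=
  (∀ x ∈ Icc 1 M, 0 < f x) ∧
  (∀ x, 1 ≤ x → x + 1 ≤ M → f (x + 1) ≤ f x) ∧
  (∑ x ∈ Icc 1 M, f x = 1)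

/-- `C` is a congestion policy for `k` players: nonnegative, nonincreasing on `1..k`,
`C 1 = 1`, and `C ℓ < 1` for some `ℓ ≤ k`. -/
def Policy (k : ℕ) (C : ℕ → ℝ) : Prop :=
  (∀ ℓ, 1 ≤ ℓ → ℓ ≤ k → 0 ≤ C ℓ) ∧ (C 1 = 1) ∧
  (∀ ℓ ℓ', 1 ≤ ℓ → ℓ ≤ ℓ' → ℓ' ≤ k → C ℓ' ≤ C ℓ) ∧
  (∃ ℓ, 1 ≤ ℓ ∧ ℓ ≤ k ∧ C ℓ < 1)

/-- The value of box `x` at round `t` against `k-1` copies of `A`. -/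
def val (k : ℕ) (C f : ℕ → ℝ) (A : ℕ → ℕ → ℝ) (x t : ℕ) : ℝ :=
  f x * ∑ ℓ ∈ range k,
    C (ℓ + 1) * ((k - 1).choose ℓ : ℝ) * A x t ^ ℓ * Nbar A x t ^ (k - 1 - ℓ)

/-- The utility of `B` against `k-1` copies of `A`. -/
def util (M T k : ℕ) (C f : ℕ → ℝ) (A B : ℕ → ℕ → ℝ) : ℝ :=
  ∑ t ∈ Icc 1 T, ∑ x ∈ Icc 1 M, B x t * val k C f A x t

/-- `A` is non-redundant: each column `t ≤ min T M` sums to exactly 1. -/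
def NonRedundant (M T : ℕ) (A : ℕ → ℕ → ℝ) : Prop :=
  ∀ t, 1 ≤ t → t ≤ min T M → ∑ x ∈ Icc 1 M, A x t = 1

/-- `A` is self-greedy: for each round `t ≤ T` it is greedy at round `t` with respect to
`k-1` copies of itself. -/
def SGreedy (M T k : ℕ) (C f : ℕ → ℝ) (A : ℕ → ℕ → ℝ) : Prop :=
  ∀ t, 1 ≤ t → t ≤ T → ∀ B, Substochastic M T B →
    (∀ x s, s < t → B x s = A x s) →
    ∑ x ∈ Icc 1 M, B x t * val k C f A x t ≤ ∑ x ∈ Icc 1 M, A x t * val k C f A x t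

/-- The remaining mass after one more round. -/
lemma Nbar_succ (A : ℕ → ℕ → ℝ) (x t : ℕ) : Nbar A x (t + 1) = Nbar A x t - A x (t + 1) := by
  unfold Nbar
  rw [Finset.sum_Icc_succ_top (by omega)]
  ring

lemma Substochastic.Nbar_nonneg {M T : ℕ} {A : ℕ → ℕ → ℝ} (hA : Substochastic M T A)
    {x t : ℕ} (hx : x ∈ Icc 1 M) (ht : t ≤ T) : 0 ≤ Nbar A x t := by
  have h : ∑ s ∈ Icc 1 t, A x s ≤ ∑ s ∈ Icc 1 T, A x s :=
    Finset.sum_le_sum_of_subset_of_nonneg (Finset.Icc_subset_Icc_right ht)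
      fun s _ _ => hA.1 x s
  have := hA.2.1 x hx
  unfold Nbar
  linarith

lemma Policy.le_one {k : ℕ} {C : ℕ → ℝ} (hC : Policy k C) {l : ℕ} (h1 : 1 ≤ l) (hl : l ≤ k) :
    C l ≤ 1 :=
  hC.2.1 ▸ hC.2.2.1 1 l le_rfl h1 hl

lemma Policy.last_lt_one {k : ℕ} {C : ℕ → ℝ} (hC : Policy k C) : C k < 1 := by
  obtain ⟨l, h1, hl, hlt⟩ := hC.2.2.2
  exact (hC.2.2.1 l k h1 hl le_rfl).trans_lt hlt

/-- The congestion sum is at least its term without any collision. -/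
lemma Policy.pow_le_sum {n : ℕ} {C : ℕ → ℝ} (hC : Policy (n + 1) C) {a q : ℝ}
    (ha : 0 ≤ a) (hq : 0 ≤ q) :
    q ^ n ≤ ∑ l ∈ range (n + 1), C (l + 1) * (n.choose l : ℝ) * a ^ l * q ^ (n - l) := by
  have h := Finset.single_le_sum
    (f := fun l => C (l + 1) * (n.choose l : ℝ) * a ^ l * q ^ (n - l))
    (fun l hl => by
      have := hC.1 (l + 1) (by omega) (by simpa using hl)
      positivity) (Finset.mem_range.2 n.succ_pos)
  simpa [hC.2.1] using h

lemma Policy.term_le {n : ℕ} {C : ℕ → ℝ} (hC : Policy (n + 1) C) {a q : ℝ}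
    (ha : 0 ≤ a) (hq : 0 ≤ q) {l : ℕ} (hl : l ∈ range (n + 1)) :
    C (l + 1) * (n.choose l : ℝ) * a ^ l * q ^ (n - l)
      ≤ a ^ l * q ^ (n - l) * (n.choose l : ℝ) := by
  have h := hC.le_one (l := l + 1) (by omega) (by simpa using hl)
  have h0 : 0 ≤ a ^ l * q ^ (n - l) * (n.choose l : ℝ) := by positivity
  nlinarith [mul_le_mul_of_nonneg_right h h0]

/-- The congestion sum is at most the binomial expansion obtained from the policy `1`. -/
lemma Policy.sum_le_pow {n : ℕ} {C : ℕ → ℝ} (hC : Policy (n + 1) C) {a q : ℝ}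
    (ha : 0 ≤ a) (hq : 0 ≤ q) :
    ∑ l ∈ range (n + 1), C (l + 1) * (n.choose l : ℝ) * a ^ l * q ^ (n - l) ≤ (a + q) ^ n := by
  rw [add_pow]
  exact Finset.sum_le_sum fun l hl => hC.term_le ha hq hl

lemma Policy.sum_lt_pow {n : ℕ} {C : ℕ → ℝ} (hC : Policy (n + 1) C) {a q : ℝ}
    (ha : 0 < a) (hq : 0 ≤ q) :
    ∑ l ∈ range (n + 1), C (l + 1) * (n.choose l : ℝ) * a ^ l * q ^ (n - l) < (a + q) ^ n := by
  rw [add_pow]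
  refine Finset.sum_lt_sum (fun l hl => hC.term_le ha.le hq hl)
    ⟨n, Finset.self_mem_range_succ n, ?_⟩
  simpa using mul_lt_of_lt_one_left (pow_pos ha n) hC.last_lt_one

/-- monotonicity of the value in time. For every box `x` and round `t` with
`t + 1 ≤ T`, `v_A(x,t+1) ≤ v_A(x,t)`, and strictly so if `A(x,t+1) > 0`. -/
theorem value_antitone_in_time
    (M T k : ℕ) (hM : 1 ≤ M) (hT : 1 ≤ T) (hk : 2 ≤ k)
    (C f : ℕ → ℝ) (hC : Policy k C) (hf : BoxDist M f)
    (A : ℕ → ℕ → ℝ) (hA : Substochastic M T A)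
    (x t : ℕ) (hx : x ∈ Icc 1 M) (ht1 : 1 ≤ t) (ht : t + 1 ≤ T) :
    val k C f A x (t + 1) ≤ val k C f A x t ∧
      (0 < A x (t + 1) → val k C f A x (t + 1) < val k C f A x t) := by
  obtain ⟨n, rfl⟩ : ∃ n, k = n + 1 := ⟨k - 1, by omega⟩
  have hfx := hf.1 x hx
  have hq : 0 ≤ Nbar A x t := hA.Nbar_nonneg hx (by omega)
  have hq' : 0 ≤ Nbar A x (t + 1) := hA.Nbar_nonneg hx ht
  have hadd : A x (t + 1) + Nbar A x (t + 1) = Nbar A x t := by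
    rw [Nbar_succ]
    ring
  have hlow := hC.pow_le_sum (hA.1 x t) hq
  simp only [_root_.val, Nat.add_sub_cancel]
  constructor
  · have hup := hC.sum_le_pow (hA.1 x (t + 1)) hq'
    rw [hadd] at hup
    exact mul_le_mul_of_nonneg_left (hup.trans hlow) hfx.le
  · intro hpos
    have hup := hC.sum_lt_pow hpos hq'
    rw [hadd] at hup
    exact mul_lt_mul_of_pos_left (hup.trans_le hlow) hfx
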